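/- Suppose Assumption A holds, with exponent α and limit function h, and fix p ∈ Δ_n. Let X be a random vector with density ρ. Then: (i) the real random variable ⟨p, X⟩ has a density ρ̃ on (0,∞) satisfying lim_{t→0^+} t^{−(n+α−1)} ρ̃(t) = (n+α) ∫_{R(p,1)} h(x) dx; and (ii) there exists a finite constant B such that γ^{n+α} 𝔼[e^{−γ ⟨p, X⟩}] ≤ B for all γ > 0. -/

import Mathlib

open MeasureTheory Filter

/-- The open unit simplex `Δ_n = {p ∈ (0,1)^n : p_1 + ⋯ + p_n = 1}`. -/
def openSimplex (n : ℕ) : Set (Fin n → ℝ) :=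
  {p | (∀ i, 0 < p i ∧ p i < 1) ∧ ∑ i, p i = 1}

/-- The open positive quadrant `(0,∞)^n`. -/
def quadrant (n : ℕ) : Set (Fin n → ℝ) := {x | ∀ i, 0 < x i}

/-- The region `R(p,a) = {x ∈ (0,∞)^n : ⟨p,x⟩ < a}`. -/
def Rset (n : ℕ) (p : Fin n → ℝ) (a : ℝ) : Set (Fin n → ℝ) :=
  {x | (∀ i, 0 < x i) ∧ ∑ i, p i * x i < a}

lemma measurableSet_quadrant (n : ℕ) : MeasurableSet (quadrant n) := by
  have : quadrant n = Set.univ.pi fun _ => Set.Ioi 0 := by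
    ext x; simp [quadrant]
  rw [this]
  exact MeasurableSet.univ_pi fun _ => measurableSet_Ioi

lemma smul_mem_quadrant_iff {n : ℕ} {t : ℝ} (ht : 0 < t) {x : Fin n → ℝ} :
    t • x ∈ quadrant n ↔ x ∈ quadrant n := by
  simp [quadrant, ht]

lemma lintegral_eq_lintegral_comp_affine {a : ℝ} (ha : 0 < a) (b : ℝ) {g : ℝ → ENNReal}
    (hg : Measurable g) :
    ∫⁻ x, g x = ENNReal.ofReal a⁻¹ * ∫⁻ t, g ((t - b) / a) := by
  have h1 : ∫⁻ t, g ((t - b) / a) = ∫⁻ t, g (a⁻¹ * t) := by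
    rw [lintegral_sub_right_eq_self (fun t => g (t / a)) b]
    simp only [div_eq_inv_mul]
  rw [h1, ← lintegral_map hg (measurable_const_mul _),
    Real.map_volume_mul_left (inv_ne_zero ha.ne'), lintegral_smul_measure, inv_inv,
    abs_of_pos ha, smul_eq_mul, ← mul_assoc, ← ENNReal.ofReal_mul (by positivity),
    inv_mul_cancel₀ ha.ne', ENNReal.ofReal_one, one_mul]

lemma lintegral_eq_lintegral_comp_smul {m : ℕ} {t : ℝ} (ht : 0 < t) {g : (Fin m → ℝ) → ENNReal}
    (hg : Measurable g) :
    ∫⁻ x, g x = ENNReal.ofReal (t ^ m) * ∫⁻ y, g (t • y) := by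
  rw [← lintegral_map hg (measurable_const_smul t), Measure.map_addHaar_smul _ ht.ne',
    lintegral_smul_measure, Module.finrank_fin_fun, abs_of_pos (by positivity), smul_eq_mul,
    ← mul_assoc, ← ENNReal.ofReal_mul (by positivity), mul_inv_cancel₀ (by positivity),
    ENNReal.ofReal_one, one_mul]

lemma lintegral_pi_fin_succ {m : ℕ} {g : (Fin (m + 1) → ℝ) → ENNReal} (hg : Measurable g) :
    ∫⁻ x, g x = ∫⁻ y : Fin m → ℝ, ∫⁻ a : ℝ, g (Fin.cons a y) := by
  rw [← (volume_preserving_piFinSuccAbove (fun _ : Fin (m + 1) => ℝ) 0).symm.lintegral_comp hg,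
    Measure.volume_eq_prod, lintegral_prod_symm]
  · simp_rw [MeasurableEquiv.piFinSuccAbove_symm_apply, Fin.insertNthEquiv, Equiv.coe_fn_mk,
      Fin.insertNth_zero']
  · exact (hg.comp (MeasurableEquiv.measurable _)).aemeasurable

/-- Disintegration of Lebesgue measure on the positive quadrant along the hyperplanes
`⟨p, x⟩ = t`, all rescaled to the slice `⟨p, x⟩ = 1`. -/
theorem exists_slice_measure {m : ℕ} {p : Fin (m + 1) → ℝ} (hp : ∀ i, 0 < p i) :
    ∃ σ : Measure (Fin (m + 1) → ℝ), IsFiniteMeasure σ ∧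
      (∀ᵐ y ∂σ, y ∈ quadrant (m + 1) ∧ ∑ i, p i * y i = 1) ∧
      ∀ f : (Fin (m + 1) → ℝ) → ENNReal, Measurable f →
        ∫⁻ x in quadrant (m + 1), f x =
          ∫⁻ t in Set.Ioi (0 : ℝ), ENNReal.ofReal (t ^ m) * ∫⁻ y, f (t • y) ∂σ := by
  have hp0 := hp 0
  let φ : (Fin m → ℝ) → (Fin (m + 1) → ℝ) :=
    fun y => Fin.cons ((1 - ∑ i, p i.succ * y i) / p 0) y
  have hφ : Measurable φ := by
    refine measurable_pi_iff.2 fun i => ?_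
    refine Fin.cases ?_ (fun j => ?_) i <;> simp only [φ, Fin.cons_zero, Fin.cons_succ] <;> fun_prop
  have hφ1 : ∀ y, ∑ i, p i * φ y i = 1 := by
    intro y
    rw [Fin.sum_univ_succ]
    simp only [φ, Fin.cons_zero, Fin.cons_succ]
    field_simp
    ring
  have hQ := measurableSet_quadrant (m + 1)
  refine ⟨(ENNReal.ofReal (p 0)⁻¹ • Measure.map φ volume).restrict (quadrant (m + 1)),
    ⟨?_⟩, ?_, ?_⟩
  · rw [Measure.restrict_apply_univ, Measure.smul_apply, Measure.map_apply hφ hQ, smul_eq_mul]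
    refine ENNReal.mul_lt_top ENNReal.ofReal_lt_top ?_
    have hsub : φ ⁻¹' quadrant (m + 1) ⊆ Set.Icc 0 fun i => (p i.succ)⁻¹ := by
      intro y hy
      have hpos : ∀ i : Fin m, 0 < y i := fun i => by simpa [φ] using hy i.succ
      refine ⟨fun i => (hpos i).le, fun i => ?_⟩
      have h1 : p i.succ * φ y i.succ ≤ ∑ i, p i * φ y i :=
        Finset.single_le_sum (f := fun i => p i * φ y i)
          (fun j _ => (mul_pos (hp j) (hy j)).le) (Finset.mem_univ _)
      rw [hφ1] at h1
      simp only [φ, Fin.cons_succ] at h1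
      exact (le_inv_mul_iff₀ (hp _)).2 h1 |>.trans_eq (mul_one _)
    exact (measure_mono hsub).trans_lt isCompact_Icc.measure_lt_top
  · refine (ae_restrict_mem hQ).and (ae_restrict_of_ae ?_)
    refine Measure.ae_smul_measure ?_ _
    refine (ae_map_iff hφ.aemeasurable (measurableSet_eq_fun (by fun_prop) (by fun_prop))).2 ?_
    exact Eventually.of_forall hφ1
  · intro f hf
    set F := (quadrant (m + 1)).indicator f with hF
    have hFm : Measurable F := hf.indicator hQ
    have hcons : Measurable fun z : (Fin m → ℝ) × ℝ => (Fin.cons z.2 z.1 : Fin (m + 1) → ℝ) := by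
      refine measurable_pi_iff.2 fun i => ?_
      refine Fin.cases ?_ (fun j => ?_) i <;> simp only [Fin.cons_zero, Fin.cons_succ] <;> fun_prop
    have hψ : Measurable fun z : (Fin m → ℝ) × ℝ =>
        F (Fin.cons ((z.2 - ∑ i, p i.succ * z.1 i) / p 0) z.1) := by
      have : Measurable fun z : (Fin m → ℝ) × ℝ =>
          (z.1, (z.2 - ∑ i, p i.succ * z.1 i) / p 0) := by fun_prop
      exact hFm.comp (hcons.comp this)
    rw [← lintegral_indicator hQ, ← hF, lintegral_pi_fin_succ hFm]
    have h1 : ∀ y : Fin m → ℝ, ∫⁻ a : ℝ, F (Fin.cons a y) = ENNReal.ofReal (p 0)⁻¹ *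
        ∫⁻ t, F (Fin.cons ((t - ∑ i, p i.succ * y i) / p 0) y) := fun y =>
      lintegral_eq_lintegral_comp_affine hp0 _ (hFm.comp (hcons.comp measurable_prodMk_left))
    simp_rw [h1]
    rw [lintegral_const_mul' _ _ ENNReal.ofReal_ne_top,
      lintegral_lintegral_swap hψ.aemeasurable, ← lintegral_const_mul' _ _ ENNReal.ofReal_ne_top,
      ← lintegral_indicator measurableSet_Ioi]
    refine lintegral_congr fun t => ?_
    have hψt : Measurable fun y : Fin m → ℝ =>
        F (Fin.cons ((t - ∑ i, p i.succ * y i) / p 0) y) := hψ.comp measurable_prodMk_right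
    by_cases ht : 0 < t
    · rw [Set.indicator_of_mem (Set.mem_Ioi.2 ht), lintegral_eq_lintegral_comp_smul ht
        hψt, Measure.restrict_smul,
        lintegral_smul_measure, ← lintegral_indicator hQ, lintegral_map _ hφ, smul_eq_mul,
        ← mul_assoc, ← mul_assoc, mul_comm (ENNReal.ofReal (t ^ m))]
      · congr 1
        refine lintegral_congr fun y => ?_
        have hty : (Fin.cons ((t - ∑ i, p i.succ * (t • y) i) / p 0) (t • y) : Fin (m + 1) → ℝ) =
            t • φ y := by
          ext i
          refine Fin.cases ?_ (fun j => ?_) i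
          · simp only [Fin.cons_zero, Pi.smul_apply, smul_eq_mul, φ, mul_left_comm _ t,
              ← Finset.mul_sum]
            ring
          · simp [φ]
        rw [hty, hF]
        by_cases hy : φ y ∈ quadrant (m + 1)
        · simp [hy, (smul_mem_quadrant_iff ht).2 hy]
        · simp [hy, mt (smul_mem_quadrant_iff ht).1 hy]
      · exact (hf.comp (measurable_const_smul t)).indicator hQ
    · rw [Set.indicator_of_notMem (by simpa using ht)]
      refine mul_eq_zero_of_right _ ?_
      rw [lintegral_eq_zero_iff hψt]
      refine Eventually.of_forall fun y => ?_
      refine Set.indicator_of_notMem (fun hy => ht ?_) _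
      have hpos : ∀ i : Fin m, 0 < y i := fun i => by simpa using hy i.succ
      have h0 : 0 < (t - ∑ i, p i.succ * y i) / p 0 := by simpa using hy 0
      have h2 : 0 ≤ ∑ i, p i.succ * y i :=
        Finset.sum_nonneg fun i _ => (mul_pos (hp _) (hpos i)).le
      have h3 := (div_pos_iff_of_pos_right hp0).1 h0
      linarith

lemma homogeneous_of_tendsto {n : ℕ} {ρ h : (Fin n → ℝ) → ℝ} {α : ℝ}
    (hpt : ∀ x ∈ quadrant n,
      Tendsto (fun κ : ℝ => ρ (κ • x) / κ ^ α) (nhdsWithin 0 (Set.Ioi 0)) (nhds (h x)))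
    {c : ℝ} (hc : 0 < c) {x : Fin n → ℝ} (hx : x ∈ quadrant n) :
    h (c • x) = c ^ α * h x := by
  have hmul : Tendsto (fun κ : ℝ => κ * c) (nhdsWithin 0 (Set.Ioi 0))
      (nhdsWithin 0 (Set.Ioi 0)) := by
    refine tendsto_nhdsWithin_iff.2 ⟨?_, ?_⟩
    · have : Tendsto (fun κ : ℝ => κ * c) (nhds 0) (nhds (0 * c)) := tendsto_id.mul_const c
      rw [zero_mul] at this
      exact this.mono_left nhdsWithin_le_nhds
    · filter_upwards [self_mem_nhdsWithin] with κ hκ using mul_pos hκ hc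
  refine tendsto_nhds_unique (hpt (c • x) ((smul_mem_quadrant_iff hc).2 hx)) ?_
  refine (((hpt x hx).comp hmul).const_mul (c ^ α)).congr' ?_
  filter_upwards [self_mem_nhdsWithin] with κ hκ
  have hκ : 0 < κ := hκ
  have h1 : 0 < κ ^ α := Real.rpow_pos_of_pos hκ _
  have h2 : 0 < c ^ α := Real.rpow_pos_of_pos hc _
  simp only [Function.comp, Real.mul_rpow hκ.le hc.le, smul_smul]
  field_simp

lemma inv_sum_smul_mem_openSimplex {n : ℕ} (hn : 2 ≤ n) {y : Fin n → ℝ} (hy : y ∈ quadrant n) :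
    (∑ i, y i)⁻¹ • y ∈ openSimplex n := by
  have : Nontrivial (Fin n) := Fin.nontrivial_iff_two_le.2 hn
  have hlt : ∀ i, y i < ∑ i, y i := fun i => by
    obtain ⟨j, hj⟩ := exists_ne i
    exact Finset.single_lt_sum hj (Finset.mem_univ _) (Finset.mem_univ _) (hy j)
      fun k _ _ => (hy k).le
  have hs : 0 < ∑ i, y i := (hy ⟨0, by omega⟩).trans (hlt _)
  refine ⟨fun i => ⟨?_, ?_⟩, ?_⟩
  · exact mul_pos (inv_pos.2 hs) (hy i)
  · simpa [inv_mul_eq_div, div_lt_one hs] using hlt i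
  · simp [← Finset.mul_sum, inv_mul_cancel₀ hs.ne']

theorem tendstoUniformlyOn_slice {n : ℕ} (hn : 2 ≤ n) {ρ h : (Fin n → ℝ) → ℝ} {α : ℝ}
    (hpt : ∀ x ∈ quadrant n,
      Tendsto (fun κ : ℝ => ρ (κ • x) / κ ^ α) (nhdsWithin 0 (Set.Ioi 0)) (nhds (h x)))
    (hunif : TendstoUniformlyOn (fun (κ : ℝ) (x : Fin n → ℝ) => ρ (κ • x) / κ ^ α) h
      (nhdsWithin 0 (Set.Ioi 0)) (openSimplex n))
    {p : Fin n → ℝ} (hp : p ∈ openSimplex n) :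
    TendstoUniformlyOn (fun (κ : ℝ) (x : Fin n → ℝ) => ρ (κ • x) / κ ^ α) h
      (nhdsWithin 0 (Set.Ioi 0)) {y | y ∈ quadrant n ∧ ∑ i, p i * y i = 1} := by
  set S : ℝ := ∑ i, (p i)⁻¹ with hS
  have hbound : ∀ y ∈ {y | y ∈ quadrant n ∧ ∑ i, p i * y i = 1},
      1 ≤ ∑ i, y i ∧ ∑ i, y i ≤ S := by
    rintro y ⟨hy, hy1⟩
    constructor
    · rw [← hy1]
      exact Finset.sum_le_sum fun i _ => mul_le_of_le_one_left (hy i).le (hp.1 i).2.le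
    · refine Finset.sum_le_sum fun i _ => ?_
      have h1 : p i * y i ≤ ∑ i, p i * y i :=
        Finset.single_le_sum (f := fun i => p i * y i)
          (fun j _ => (mul_pos (hp.1 j).1 (hy j)).le) (Finset.mem_univ _)
      exact (le_inv_mul_iff₀ (hp.1 i).1).2 (h1.trans_eq hy1) |>.trans_eq (mul_one _)
  have hSpos : 0 < S :=
    Finset.sum_pos (fun i _ => inv_pos.2 (hp.1 i).1) ⟨⟨0, by omega⟩, Finset.mem_univ _⟩
  have hC : 0 < S ^ |α| := Real.rpow_pos_of_pos hSpos _
  rw [Metric.tendstoUniformlyOn_iff] at hunif ⊢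
  intro ε hε
  obtain ⟨δ, hδ, hδu⟩ := mem_nhdsGT_iff_exists_Ioo_subset.1 (hunif (ε / S ^ |α|) (by positivity))
  filter_upwards [Ioo_mem_nhdsGT (div_pos (Set.mem_Ioi.1 hδ) hSpos)] with κ hκ y hy
  obtain ⟨hs1, hs2⟩ := hbound y hy
  set s := ∑ i, y i with hs
  have hs0 : 0 < s := by linarith
  have hsα : s ^ α ≤ S ^ |α| :=
    (Real.rpow_le_rpow_of_exponent_le hs1 (le_abs_self α)).trans
      (Real.rpow_le_rpow hs0.le hs2 (abs_nonneg α))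
  have hκs : κ * s ∈ Set.Ioo 0 δ :=
    ⟨mul_pos hκ.1 hs0, (mul_le_mul_of_nonneg_left hs2 hκ.1.le).trans_lt
      ((lt_div_iff₀ hSpos).1 hκ.2)⟩
  have hu := hδu hκs _ (inv_sum_smul_mem_openSimplex hn hy.1)
  rw [← hs, smul_smul, mul_assoc, mul_inv_cancel₀ hs0.ne', mul_one,
    homogeneous_of_tendsto hpt (inv_pos.2 hs0) hy.1, Real.inv_rpow hs0.le,
    Real.mul_rpow hκ.1.le hs0.le, Real.dist_eq] at hu
  have hsα0 : 0 < s ^ α := Real.rpow_pos_of_pos hs0 _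
  have hκα0 : 0 < κ ^ α := Real.rpow_pos_of_pos hκ.1 _
  have key : (s ^ α)⁻¹ * h y - ρ (κ • y) / (κ ^ α * s ^ α) =
      (s ^ α)⁻¹ * (h y - ρ (κ • y) / κ ^ α) := by
    field_simp
  rw [key, abs_mul, abs_of_pos (inv_pos.2 hsα0), inv_mul_lt_iff₀ hsα0] at hu
  rw [Real.dist_eq]
  refine hu.trans_le ?_
  rw [mul_div_assoc', div_le_iff₀ hC, mul_comm]
  exact mul_le_mul_of_nonneg_left hsα hε.le

theorem exists_laplace_bound {f : ℝ → ℝ} (hf : Integrable f) (hf0 : ∀ t, 0 ≤ f t)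
    (hfneg : ∀ t ≤ 0, f t = 0) {s C T : ℝ} (hs : 0 < s) (hT : 0 < T) (hC : 0 ≤ C)
    (hle : ∀ t ∈ Set.Ioo 0 T, f t ≤ C * t ^ (s - 1)) :
    ∃ B : ℝ, ∀ γ : ℝ, 0 < γ → γ ^ s * ∫ t, f t * Real.exp (-γ * t) ≤ B := by
  obtain ⟨G, hG⟩ := eventually_atTop.1
    ((tendsto_rpow_mul_exp_neg_mul_atTop_nhds_zero s T hT).eventually
      (eventually_le_nhds zero_lt_one))
  have hdecay : ∀ γ : ℝ, 0 < γ → γ ^ s * Real.exp (-γ * T) ≤ 1 + |G| ^ s := by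
    intro γ hγ
    have hGs : 0 ≤ |G| ^ s := Real.rpow_nonneg (abs_nonneg G) s
    rcases le_total G γ with h | h
    · have := hG γ h
      rw [neg_mul, mul_comm T γ, ← neg_mul] at this
      linarith
    · have h1 : γ ^ s ≤ |G| ^ s := Real.rpow_le_rpow hγ.le (h.trans (le_abs_self G)) hs.le
      have h2 : Real.exp (-γ * T) ≤ 1 := Real.exp_le_one_iff.2 (by nlinarith)
      have h3 := mul_le_mul h1 h2 (Real.exp_pos _).le hGs
      linarith
  refine ⟨C * Real.Gamma s + (1 + |G| ^ s) * ∫ t, f t, fun γ hγ => ?_⟩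
  have hγs : 0 < γ ^ s := Real.rpow_pos_of_pos hγ s
  have hgam := Real.integral_rpow_mul_exp_neg_mul_Ioi hs hγ
  have hgamint : IntegrableOn (fun t : ℝ => t ^ (s - 1) * Real.exp (-(γ * t))) (Set.Ioi 0) := by
    by_contra hcon
    rw [integral_undef hcon] at hgam
    have := mul_pos (Real.rpow_pos_of_pos (one_div_pos.2 hγ) s) (Real.Gamma_pos_of_pos hs)
    linarith
  have hind : Integrable ((Set.Ioi (0 : ℝ)).indicator
      fun t => t ^ (s - 1) * Real.exp (-(γ * t))) :=
    (integrable_indicator_iff measurableSet_Ioi).2 hgamint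
  have hmono : ∫ t, f t * Real.exp (-γ * t) ≤ ∫ t, (C * (Set.Ioi (0 : ℝ)).indicator
      (fun t => t ^ (s - 1) * Real.exp (-(γ * t))) t + Real.exp (-γ * T) * f t) := by
    refine integral_mono_of_nonneg (Eventually.of_forall fun t => mul_nonneg (hf0 t)
      (Real.exp_pos _).le) ((hind.const_mul C).add (hf.const_mul _))
      (Eventually.of_forall fun t => ?_)
    have hexp : 0 ≤ Real.exp (-γ * T) * f t := mul_nonneg (Real.exp_pos _).le (hf0 t)
    rcases le_or_gt t 0 with ht | ht
    · simp [hfneg t ht, ht.not_gt]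
    · simp only [Set.indicator_of_mem (Set.mem_Ioi.2 ht)]
      rcases lt_or_ge t T with htT | htT
      · have := mul_le_mul_of_nonneg_right (hle t ⟨ht, htT⟩) (Real.exp_pos (-γ * t)).le
        simp only [neg_mul] at this hexp ⊢
        rw [← mul_assoc]
        linarith
      · have h1 : Real.exp (-γ * t) ≤ Real.exp (-γ * T) := Real.exp_le_exp.2 (by nlinarith)
        have h2 := mul_le_mul_of_nonneg_left h1 (hf0 t)
        have h3 : 0 ≤ C * (t ^ (s - 1) * Real.exp (-(γ * t))) := by positivity
        linarith
  rw [integral_add (hind.const_mul C) (hf.const_mul _), integral_const_mul, integral_const_mul,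
    integral_indicator measurableSet_Ioi, hgam, Real.div_rpow zero_le_one hγ.le,
    Real.one_rpow] at hmono
  calc γ ^ s * ∫ t, f t * Real.exp (-γ * t)
      ≤ γ ^ s * (C * (1 / γ ^ s * Real.Gamma s) + Real.exp (-γ * T) * ∫ t, f t) :=
        mul_le_mul_of_nonneg_left hmono hγs.le
    _ = C * Real.Gamma s + γ ^ s * Real.exp (-γ * T) * ∫ t, f t := by field_simp
    _ ≤ C * Real.Gamma s + (1 + |G| ^ s) * ∫ t, f t := by
        gcongr
        · exact integral_nonneg hf0
        · exact hdecay γ hγ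

lemma setLIntegral_quadrant_mul_comp {m : ℕ} {p : Fin (m + 1) → ℝ}
    {σ : Measure (Fin (m + 1) → ℝ)}
    (hσ : ∀ᵐ y ∂σ, y ∈ quadrant (m + 1) ∧ ∑ i, p i * y i = 1)
    (hpol : ∀ f : (Fin (m + 1) → ℝ) → ENNReal, Measurable f →
      ∫⁻ x in quadrant (m + 1), f x =
        ∫⁻ t in Set.Ioi (0 : ℝ), ENNReal.ofReal (t ^ m) * ∫⁻ y, f (t • y) ∂σ)
    {f : (Fin (m + 1) → ℝ) → ℝ} (hf : Measurable f) (hf0 : ∀ x ∈ quadrant (m + 1), 0 ≤ f x)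
    (hint : ∀ᵐ t ∂volume.restrict (Set.Ioi (0 : ℝ)), Integrable (fun y => f (t • y)) σ)
    {g : ℝ → ENNReal} (hg : Measurable g) :
    ∫⁻ x in quadrant (m + 1), ENNReal.ofReal (f x) * g (∑ i, p i * x i) =
      ∫⁻ t in Set.Ioi (0 : ℝ), ENNReal.ofReal (t ^ m * ∫ y, f (t • y) ∂σ) * g t := by
  rw [hpol _ (by fun_prop)]
  refine lintegral_congr_ae ?_
  filter_upwards [hint, ae_restrict_mem measurableSet_Ioi] with t ht ht0
  have ht0 : 0 < t := ht0
  have h0 : 0 ≤ᵐ[σ] fun y => f (t • y) := by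
    filter_upwards [hσ] with y hy using hf0 _ ((smul_mem_quadrant_iff ht0).2 hy.1)
  have h1 : ∫⁻ y, ENNReal.ofReal (f (t • y)) * g (∑ i, p i * (t • y) i) ∂σ =
      ∫⁻ y, ENNReal.ofReal (f (t • y)) * g t ∂σ := by
    refine lintegral_congr_ae ?_
    filter_upwards [hσ] with y hy
    simp only [Pi.smul_apply, smul_eq_mul, mul_left_comm _ t, ← Finset.mul_sum, hy.2, mul_one]
  rw [h1, lintegral_mul_const _ (by fun_prop), ENNReal.ofReal_mul (by positivity),
    ofReal_integral_eq_lintegral_ofReal ht h0, mul_assoc]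

/-- under Assumption A, for `p ∈ Δ_n` and `X` a random vector with
density `ρ`: (i) `⟨p,X⟩` has a density `ρ̃` on `(0,∞)` with
`ρ̃(t)/t^{n+α−1} → (n+α) ∫_{R(p,1)} h` as `t → 0⁺`; and (ii) there is `B < ∞` with
`γ^{n+α} 𝔼[e^{−γ⟨p,X⟩}] ≤ B` for all `γ > 0`. -/
theorem density_and_laplace_bound (n : ℕ) (hn : 2 ≤ n)
    (ρ : (Fin n → ℝ) → ℝ) (hρmeas : Measurable ρ) (hρnonneg : ∀ x, 0 ≤ ρ x)
    (hρprob : ∫⁻ x in quadrant n, ENNReal.ofReal (ρ x) = 1)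
    (α : ℝ) (h : (Fin n → ℝ) → ℝ) (hhmeas : Measurable h)
    (hhnonneg : ∀ x ∈ quadrant n, 0 ≤ h x)
    (hhpos : 0 < ∫⁻ x in quadrant n, ENNReal.ofReal (h x))
    (hpt : ∀ x ∈ quadrant n,
      Tendsto (fun κ : ℝ => ρ (κ • x) / κ ^ α) (nhdsWithin 0 (Set.Ioi 0)) (nhds (h x)))
    (hunif : TendstoUniformlyOn (fun (κ : ℝ) (x : Fin n → ℝ) => ρ (κ • x) / κ ^ α) h
      (nhdsWithin 0 (Set.Ioi 0)) (openSimplex n))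
    (p : Fin n → ℝ) (hp : p ∈ openSimplex n)
    {Ω : Type*} [MeasurableSpace Ω] (P : Measure Ω) [IsProbabilityMeasure P]
    (X : Ω → Fin n → ℝ) (hXmeas : Measurable X)
    (hlaw : Measure.map X P =
      ((volume.restrict (quadrant n)).withDensity fun x => ENNReal.ofReal (ρ x))) :
    (∃ ρt : ℝ → ℝ, Measurable ρt ∧ (∀ t, 0 ≤ ρt t) ∧ (∀ t ≤ 0, ρt t = 0) ∧
      Measure.map (fun ω => ∑ i, p i * X ω i) P =
        (volume.withDensity fun t => ENNReal.ofReal (ρt t)) ∧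
      Tendsto (fun t : ℝ => ρt t / t ^ ((n : ℝ) + α - 1))
        (nhdsWithin 0 (Set.Ioi 0))
        (nhds (((n : ℝ) + α) * ∫ x in Rset n p 1, h x))) ∧
    (∃ B : ℝ, ∀ γ : ℝ, 0 < γ →
      γ ^ ((n : ℝ) + α) * ∫ ω, Real.exp (-γ * ∑ i, p i * X ω i) ∂P ≤ B) := by
  obtain ⟨m, rfl⟩ : ∃ m, n = m + 1 := ⟨n - 1, by omega⟩
  obtain ⟨σ, hσfin, hσ, hpol⟩ := exists_slice_measure fun i => (hp.1 i).1
  have hQ := measurableSet_quadrant (m + 1)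
  have hslice := tendstoUniformlyOn_slice hn hpt hunif hp
  set r : ℝ → ℝ := fun t => ∫ y, ρ (t • y) ∂σ with hr
  have hr0 : ∀ t, 0 ≤ r t := fun t => integral_nonneg fun y => hρnonneg _
  have hρsmul : Measurable fun z : ℝ × (Fin (m + 1) → ℝ) => ρ (z.1 • z.2) := by fun_prop
  have hrmeas : Measurable r := hρsmul.stronglyMeasurable.integral_prod_right.measurable
  have hρint : ∀ᵐ t ∂volume.restrict (Set.Ioi (0 : ℝ)), Integrable (fun y => ρ (t • y)) σ := by
    have h1 := hpol _ hρmeas.ennreal_ofReal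
    rw [hρprob] at h1
    have hF : Measurable fun t : ℝ => ∫⁻ y, ENNReal.ofReal (ρ (t • y)) ∂σ :=
      hρsmul.ennreal_ofReal.lintegral_prod_right'
    have h2 := ae_lt_top (Measurable.mul (by fun_prop) hF) (h1 ▸ ENNReal.one_ne_top)
    filter_upwards [h2, ae_restrict_mem measurableSet_Ioi] with t ht ht0
    have ht0 : 0 < t := ht0
    refine ⟨(by fun_prop : Measurable fun y => ρ (t • y)).aestronglyMeasurable, ?_⟩
    rw [hasFiniteIntegral_iff_ofReal (Eventually.of_forall fun y => hρnonneg _)]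
    rcases ENNReal.mul_lt_top_iff.1 ht with h | h | h
    · exact h.2
    · exact absurd (ENNReal.ofReal_eq_zero.1 h) (by simpa using pow_pos ht0 m)
    · exact h.trans_lt ENNReal.zero_lt_top
  set ρt : ℝ → ℝ := (Set.Ioi (0 : ℝ)).indicator fun t => t ^ m * r t with hρt
  have hρtmeas : Measurable ρt := ((measurable_id.pow_const m).mul hrmeas).indicator
    measurableSet_Ioi
  have hρt0 : ∀ t, 0 ≤ ρt t := Set.indicator_nonneg fun t ht =>
    mul_nonneg (pow_nonneg (le_of_lt ht) m) (hr0 t)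
  have hρtneg : ∀ t ≤ 0, ρt t = 0 := fun t ht => Set.indicator_of_notMem (by simpa using ht) _
  have hρtpos : ∀ t, 0 < t → ρt t = t ^ m * r t := fun t ht =>
    Set.indicator_of_mem (Set.mem_Ioi.2 ht) _
  have hZ : Measurable fun x : Fin (m + 1) → ℝ => ∑ i, p i * x i := by fun_prop
  have hformula : ∀ g : ℝ → ENNReal, Measurable g →
      ∫⁻ x in quadrant (m + 1), ENNReal.ofReal (ρ x) * g (∑ i, p i * x i) =
        ∫⁻ t, ENNReal.ofReal (ρt t) * g t := by
    intro g hg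
    rw [setLIntegral_quadrant_mul_comp hσ hpol hρmeas (fun x _ => hρnonneg x) hρint hg,
      ← lintegral_indicator measurableSet_Ioi]
    refine lintegral_congr fun t => ?_
    by_cases ht : 0 < t
    · simp [ht, hρtpos t ht, hr]
    · simp [ht, hρtneg t (not_lt.1 ht)]
  have hρtint : Integrable ρt := by
    refine ⟨hρtmeas.aestronglyMeasurable, ?_⟩
    rw [hasFiniteIntegral_iff_ofReal (Eventually.of_forall hρt0)]
    have := hformula (fun _ => 1) measurable_const
    simp only [mul_one, hρprob] at this
    rw [← this]
    exact ENNReal.one_lt_top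
  have hmap : Measure.map (fun ω => ∑ i, p i * X ω i) P =
      volume.withDensity fun t => ENNReal.ofReal (ρt t) := by
    have h1 : Measure.map (fun ω => ∑ i, p i * X ω i) P =
        Measure.map (fun x : Fin (m + 1) → ℝ => ∑ i, p i * x i) (Measure.map X P) :=
      (Measure.map_map hZ hXmeas).symm
    ext S hS
    rw [h1, hlaw, Measure.map_apply hZ hS, withDensity_apply _ (hZ hS), withDensity_apply _ hS,
      ← lintegral_indicator (hZ hS), ← lintegral_indicator hS]
    refine (lintegral_congr fun x => ?_).trans
      ((hformula (S.indicator 1) (measurable_one.indicator hS)).trans (lintegral_congr fun t => ?_))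
    · by_cases hx : (∑ i, p i * x i) ∈ S <;> simp [hx]
    · by_cases ht : t ∈ S <;> simp [ht]
  have hnear : ∀ᶠ κ in nhdsWithin (0 : ℝ) (Set.Ioi 0),
      ∀ᵐ y ∂σ, |h y - ρ (κ • y) / κ ^ α| < 1 := by
    filter_upwards [Metric.tendstoUniformlyOn_iff.1 hslice 1 one_pos] with κ hκ
    filter_upwards [hσ] with y hy using by simpa [Real.dist_eq] using hκ y hy
  have hhint : Integrable h σ := by
    obtain ⟨δ, hδ, hδu⟩ := mem_nhdsGT_iff_exists_Ioo_subset.1 hnear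
    have h1 := ae_restrict_of_ae_restrict_of_subset 
      (Set.Ioo_subset_Ioi_self : Set.Ioo 0 δ ⊆ Set.Ioi 0) hρint
    have : NeBot (ae (volume.restrict (Set.Ioo 0 δ))) := by
      rw [ae_neBot, Ne, Measure.restrict_eq_zero, Real.volume_Ioo, ENNReal.ofReal_eq_zero]
      simpa using hδ
    obtain ⟨κ, hκint, hκ⟩ := (h1.and (ae_restrict_mem measurableSet_Ioo)).exists
    refine ((hκint.div_const (κ ^ α)).norm.add (integrable_const (1 : ℝ))).mono'
      hhmeas.aestronglyMeasurable ?_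
    filter_upwards [hδu hκ] with y hy
    have := abs_sub_abs_le_abs_sub (h y) (ρ (κ • y) / κ ^ α)
    simp only [Pi.add_apply, Real.norm_eq_abs]
    linarith
  set H : ℝ := ∫ y, h y ∂σ with hH
  have hlim : Tendsto (fun κ => r κ / κ ^ α) (nhdsWithin 0 (Set.Ioi 0)) (nhds H) := by
    simp only [hr, ← integral_div]
    refine tendsto_integral_filter_of_dominated_convergence (fun y => |h y| + 1)
      (Eventually.of_forall fun κ => ?_) ?_ (hhint.abs.add (integrable_const 1)) ?_
    · exact (by fun_prop : Measurable fun y => ρ (κ • y) / κ ^ α).aestronglyMeasurable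
    · filter_upwards [hnear] with κ hκ
      filter_upwards [hκ] with y hy
      have := abs_sub_abs_le_abs_sub (ρ (κ • y) / κ ^ α) (h y)
      rw [abs_sub_comm] at this
      rw [Real.norm_eq_abs]
      linarith
    · filter_upwards [hσ] with y hy using hpt y hy.1
  have hhsmul : ∀ t : ℝ, 0 < t → (fun y => h (t • y)) =ᵐ[σ] fun y => t ^ α * h y := by
    intro t ht
    filter_upwards [hσ] with y hy using homogeneous_of_tendsto hpt ht hy.1
  have hhformula : ∀ g : ℝ → ENNReal, Measurable g →
      ∫⁻ x in quadrant (m + 1), ENNReal.ofReal (h x) * g (∑ i, p i * x i) =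
        ∫⁻ t in Set.Ioi (0 : ℝ), ENNReal.ofReal (t ^ ((m : ℝ) + α) * H) * g t := by
    intro g hg
    rw [setLIntegral_quadrant_mul_comp hσ hpol hhmeas hhnonneg ?_ hg]
    · refine setLIntegral_congr_fun measurableSet_Ioi fun t ht => ?_
      have ht : 0 < t := ht
      simp only [integral_congr_ae (hhsmul t ht), integral_const_mul, ← hH, Real.rpow_add ht,
        Real.rpow_natCast, mul_assoc]
    · filter_upwards [ae_restrict_mem measurableSet_Ioi] with t ht
      exact (hhint.const_mul _).congr (hhsmul t ht).symm
  have hHpos : 0 < H := by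
    refine lt_of_not_ge fun hcon => hhpos.ne' ?_
    have h1 := hhformula (fun _ => 1) measurable_const
    simp only [mul_one] at h1
    rw [h1]
    refine (setLIntegral_congr_fun measurableSet_Ioi fun t ht => ?_).trans lintegral_zero
    exact ENNReal.ofReal_eq_zero.2
      (mul_nonpos_of_nonneg_of_nonpos (Real.rpow_nonneg (le_of_lt ht) _) hcon)
  have hexp : -1 < (m : ℝ) + α := by
    obtain ⟨δ, hδ, hδu⟩ := mem_nhdsGT_iff_exists_Ioo_subset.1
      (hlim.eventually (eventually_gt_nhds (half_lt_self hHpos)))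
    rw [← intervalIntegral.integrableOn_Ioo_rpow_iff (Set.mem_Ioi.1 hδ)]
    refine (hρtint.const_mul (H / 2)⁻¹).integrableOn.mono'
      (by fun_prop : Measurable fun t : ℝ => t ^ ((m : ℝ) + α)).aestronglyMeasurable ?_
    filter_upwards [ae_restrict_mem measurableSet_Ioo] with t ht
    have h1 : H / 2 < r t / t ^ α := hδu ht
    have ht0 : 0 < t := ht.1
    rw [lt_div_iff₀ (Real.rpow_pos_of_pos ht0 _)] at h1
    rw [Real.norm_of_nonneg (Real.rpow_nonneg ht0.le _), hρtpos t ht0,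
      le_inv_mul_iff₀ (by positivity), Real.rpow_add ht0, Real.rpow_natCast, mul_left_comm]
    exact mul_le_mul_of_nonneg_left h1.le (by positivity)
  have hR : ((m + 1 : ℕ) + α) * ∫ x in Rset (m + 1) p 1, h x = H := by
    have hRQ : Rset (m + 1) p 1 =
        (fun x : Fin (m + 1) → ℝ => ∑ i, p i * x i) ⁻¹' Set.Iio 1 ∩ quadrant (m + 1) := by
      ext x; simp [Rset, quadrant, and_comm]
    have hRmeas : MeasurableSet (Rset (m + 1) p 1) := hRQ ▸ (hZ measurableSet_Iio).inter hQ
    have h1 : ∫⁻ x in Rset (m + 1) p 1, ENNReal.ofReal (h x) =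
        ∫⁻ t in Set.Ioo (0 : ℝ) 1, ENNReal.ofReal (t ^ ((m : ℝ) + α) * H) := by
      have h2 := hhformula ((Set.Iio 1).indicator 1) (measurable_one.indicator measurableSet_Iio)
      rw [hRQ, ← Measure.restrict_restrict (hZ measurableSet_Iio),
        ← lintegral_indicator (hZ measurableSet_Iio), ← Set.Iio_inter_Ioi,
        ← Measure.restrict_restrict measurableSet_Iio, ← lintegral_indicator measurableSet_Iio]
      refine (lintegral_congr fun x => ?_).trans (h2.trans (lintegral_congr fun t => ?_))
      · by_cases hx : (∑ i, p i * x i) < 1 <;> simp [hx]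
      · by_cases ht : t < 1 <;> simp [ht]
    have h3 : ∫ x in Rset (m + 1) p 1, h x = ∫ t in Set.Ioo (0 : ℝ) 1, t ^ ((m : ℝ) + α) * H := by
      rw [integral_eq_lintegral_of_nonneg_ae _ hhmeas.aestronglyMeasurable, h1,
        integral_eq_lintegral_of_nonneg_ae]
      · filter_upwards [ae_restrict_mem measurableSet_Ioo] with t ht
        exact mul_nonneg (Real.rpow_nonneg ht.1.le _) hHpos.le
      · exact (by fun_prop : Measurable fun t : ℝ => t ^ ((m : ℝ) + α) * H).aestronglyMeasurable
      · filter_upwards [ae_restrict_mem hRmeas] with x hx using hhnonneg x hx.1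
    have h4 : (m : ℝ) + α + 1 ≠ 0 := by linarith
    rw [h3, integral_mul_const, ← integral_Ioc_eq_integral_Ioo,
      ← intervalIntegral.integral_of_le zero_le_one, integral_rpow (Or.inl hexp),
      Real.one_rpow, Real.zero_rpow h4]
    push_cast
    field_simp
    ring
  have hsplit : ∀ t : ℝ, 0 < t → t ^ (((m + 1 : ℕ) : ℝ) + α - 1) = t ^ m * t ^ α := by
    intro t ht
    rw [← Real.rpow_natCast t m, ← Real.rpow_add ht]
    congr 1
    push_cast
    ring
  refine ⟨⟨ρt, hρtmeas, hρt0, hρtneg, hmap, ?_⟩, ?_⟩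
  · rw [hR]
    refine hlim.congr' ?_
    filter_upwards [self_mem_nhdsWithin] with t ht
    have ht : 0 < t := ht
    rw [hρtpos t ht, hsplit t ht, mul_div_mul_left _ _ (pow_pos ht m).ne']
  · obtain ⟨T, hT, hTu⟩ := mem_nhdsGT_iff_exists_Ioo_subset.1
      (hlim.eventually (eventually_lt_nhds (lt_add_one H)))
    have hle : ∀ t ∈ Set.Ioo 0 T, ρt t ≤ (H + 1) * t ^ (((m + 1 : ℕ) : ℝ) + α - 1) := by
      intro t ht
      have h1 : r t / t ^ α < H + 1 := hTu ht
      rw [div_lt_iff₀ (Real.rpow_pos_of_pos ht.1 _)] at h1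
      rw [hρtpos t ht.1, hsplit t ht.1, mul_left_comm]
      exact mul_le_mul_of_nonneg_left h1.le (pow_nonneg ht.1.le m)
    obtain ⟨B, hB⟩ := exists_laplace_bound hρtint hρt0 hρtneg (by push_cast; linarith) hT
      (by linarith) hle
    refine ⟨B, fun γ hγ => ?_⟩
    have hlaplace : ∫ ω, Real.exp (-γ * ∑ i, p i * X ω i) ∂P =
        ∫ t, ρt t * Real.exp (-γ * t) := by
      have hexpm : Measurable fun t : ℝ => Real.exp (-γ * t) := by fun_prop
      rw [← integral_map (φ := fun ω => ∑ i, p i * X ω i) (f := fun t => Real.exp (-γ * t))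
        (hZ.comp hXmeas).aemeasurable hexpm.aestronglyMeasurable, hmap,
        integral_withDensity_eq_integral_toReal_smul hρtmeas.ennreal_ofReal
          (Eventually.of_forall fun _ => ENNReal.ofReal_lt_top)]
      simp only [ENNReal.toReal_ofReal (hρt0 _), smul_eq_mul]
    rw [hlaplace]
    exact hB γ hγ
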